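/- Lyapunov property of the cubic barrier in the second strip: let f(x) := (1/4) sin(2x) + (29/18) x cos(2x) and define the polynomial p(x) := 3/100 + (15/4)(x − 11/2) + (18/89)(x − 11/2)² − (136/181)(x − 11/2)³. Then p(x)(1 + p'(x)) − f(x) > 0 for every x ∈ (18/5, 11/2). -/

import Mathlib

open Set

/-- The cubic barrier in the second strip. -/
noncomputable def barrierP (x : ℝ) : ℝ :=
  3/100 + (15/4) * (x - 11/2) + (18/89) * (x - 11/2) ^ 2 - (136/181) * (x - 11/2) ^ 3

/-- A function vanishing at `0` with nonnegative derivative on `[0, ∞)` is nonnegative there. -/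
lemma nonneg_of_hasDerivAt_nonneg {f f' : ℝ → ℝ} (hf : ∀ x, HasDerivAt f (f' x) x)
    (hf' : ∀ x, 0 ≤ x → 0 ≤ f' x) (h0 : f 0 = 0) {x : ℝ} (hx : 0 ≤ x) : 0 ≤ f x := by
  have hmono : MonotoneOn f (Ici 0) := by
    apply monotoneOn_of_deriv_nonneg (convex_Ici 0)
      (fun y _ => (hf y).continuousAt.continuousWithinAt)
      (fun y _ => (hf y).differentiableAt.differentiableWithinAt)
    intro y hy
    rw [interior_Ici, mem_Ioi] at hy
    rw [(hf y).deriv]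
    exact hf' y hy.le
  simpa [h0] using hmono (mem_Ici.2 le_rfl) (mem_Ici.2 hx) hx

lemma sub_cube_le_sin {x : ℝ} (hx : 0 ≤ x) : x - x ^ 3 / 6 ≤ Real.sin x := by
  rcases hx.eq_or_lt with rfl | hx
  · simp
  · exact (Real.sin_gt_sub_cube hx).le

lemma cos_le_taylor_four {x : ℝ} (hx : 0 ≤ x) :
    Real.cos x ≤ 1 - x ^ 2 / 2 + x ^ 4 / 24 := by
  have h := nonneg_of_hasDerivAt_nonneg
    (f := fun y => 1 - y ^ 2 / 2 + y ^ 4 / 24 - Real.cos y)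
    (f' := fun y => Real.sin y - (y - y ^ 3 / 6))
    (fun y => by
      convert! ((((hasDerivAt_id y).pow 2).div_const 2).const_sub 1).add
        (((hasDerivAt_id y).pow 4).div_const 24) |>.sub (Real.hasDerivAt_cos y) using 1
      simp
      ring)
    (fun y hy => sub_nonneg.2 (sub_cube_le_sin hy)) (by simp) hx
  exact sub_nonneg.1 h

lemma sin_le_taylor_five {x : ℝ} (hx : 0 ≤ x) :
    Real.sin x ≤ x - x ^ 3 / 6 + x ^ 5 / 120 := by
  have h := nonneg_of_hasDerivAt_nonneg
    (f := fun y => y - y ^ 3 / 6 + y ^ 5 / 120 - Real.sin y)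
    (f' := fun y => 1 - y ^ 2 / 2 + y ^ 4 / 24 - Real.cos y)
    (fun y => by
      convert! ((hasDerivAt_id y).sub (((hasDerivAt_id y).pow 3).div_const 6)).add
        (((hasDerivAt_id y).pow 5).div_const 120) |>.sub (Real.hasDerivAt_sin y) using 1
      simp
      ring)
    (fun y hy => sub_nonneg.2 (cos_le_taylor_four hy)) (by simp) hx
  exact sub_nonneg.1 h

lemma taylor_six_le_cos_of_nonneg {x : ℝ} (hx : 0 ≤ x) :
    1 - x ^ 2 / 2 + x ^ 4 / 24 - x ^ 6 / 720 ≤ Real.cos x := by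
  have h := nonneg_of_hasDerivAt_nonneg
    (f := fun y => Real.cos y - (1 - y ^ 2 / 2 + y ^ 4 / 24 - y ^ 6 / 720))
    (f' := fun y => y - y ^ 3 / 6 + y ^ 5 / 120 - Real.sin y)
    (fun y => by
      convert! (Real.hasDerivAt_cos y).sub
        (((((hasDerivAt_id y).pow 2).div_const 2).const_sub 1).add
          (((hasDerivAt_id y).pow 4).div_const 24) |>.sub
            (((hasDerivAt_id y).pow 6).div_const 720)) using 1
      simp
      ring)
    (fun y hy => sub_nonneg.2 (sin_le_taylor_five hy)) (by simp) hx
  exact sub_nonneg.1 h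

lemma taylor_six_le_cos (x : ℝ) :
    1 - x ^ 2 / 2 + x ^ 4 / 24 - x ^ 6 / 720 ≤ Real.cos x := by
  have h := taylor_six_le_cos_of_nonneg (abs_nonneg x)
  rwa [Real.cos_abs, (by decide : Even 2).pow_abs, (by decide : Even 4).pow_abs,
    (by decide : Even 6).pow_abs] at h

lemma taylor_five_le_sin {x : ℝ} (hx : x ≤ 0) :
    x - x ^ 3 / 6 + x ^ 5 / 120 ≤ Real.sin x := by
  have h := sin_le_taylor_five (neg_nonneg.2 hx)
  rw [Real.sin_neg] at h
  linarith [(by ring : -x - (-x) ^ 3 / 6 + (-x) ^ 5 / 120 = -(x - x ^ 3 / 6 + x ^ 5 / 120))]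

lemma deriv_barrierP (x : ℝ) :
    deriv barrierP x = 15/4 + (36/89) * (x - 11/2) - (408/181) * (x - 11/2) ^ 2 := by
  have h := (hasDerivAt_id x).sub_const (11/2)
  have H : HasDerivAt barrierP
      (15/4 + (36/89) * (x - 11/2) - (408/181) * (x - 11/2) ^ 2) x := by
    convert! (((h.const_mul (15/4)).const_add (3/100)).add ((h.pow 2).const_mul (18/89))).sub
      ((h.pow 3).const_mul (136/181)) using 1
    simp
    ring
  exact H.deriv

/-- Shifting by `9.42478`, a rational approximation of `3π`, flips the sign of the trigonometric
terms up to a small error. -/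
lemma trig_lower_bound {x : ℝ} (hx : x ∈ Ioo (18/5 : ℝ) (11/2)) :
    (1/4) * Real.sin (2 * x - 9.42478) + (29/18) * x * Real.cos (2 * x - 9.42478) - 1/1000 ≤
      -((1/4) * Real.sin (2 * x) + (29/18) * x * Real.cos (2 * x)) := by
  obtain ⟨hx1, hx2⟩ := hx
  have hπ : |(2 * x - 9.42478) - (2 * x - 3 * Real.pi)| ≤ 1/100000 := by
    rw [abs_le]
    constructor <;> linarith [Real.pi_gt_d6, Real.pi_lt_d6]
  have hs : Real.sin (2 * x) = -Real.sin (2 * x - 3 * Real.pi) := by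
    rw [← Real.sin_add_pi, ← Real.sin_sub_two_pi (2 * x)]
    ring_nf
  have hc : Real.cos (2 * x) = -Real.cos (2 * x - 3 * Real.pi) := by
    rw [← Real.cos_add_pi, ← Real.cos_sub_two_pi (2 * x)]
    ring_nf
  have h1 := (abs_le.1 ((Real.abs_sin_sub_sin_le _ _).trans hπ)).2
  have h2 := (abs_le.1 ((Real.abs_cos_sub_cos_le _ _).trans hπ)).2
  rw [hs, hc]
  nlinarith [mul_le_mul_of_nonneg_left h2 (by linarith : (0 : ℝ) ≤ x)]

/-- Positivity is read off from the Bernstein coefficients on the interval. -/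
lemma barrier_poly_pos_of_nonpos {v : ℝ} (hv1 : -2.22478 ≤ v) (hv2 : v ≤ 0) :
    0 < (3/100 + (15/4) * (v / 2 - 0.78761) + (18/89) * (v / 2 - 0.78761) ^ 2
          - (136/181) * (v / 2 - 0.78761) ^ 3)
        * (1 + (15/4 + (36/89) * (v / 2 - 0.78761) - (408/181) * (v / 2 - 0.78761) ^ 2))
      + ((1/4) * (v - v ^ 3 / 6 + v ^ 5 / 120)
        + (29/18) * (v / 2 + 4.71239) * (1 - v ^ 2 / 2 + v ^ 4 / 24 - v ^ 6 / 720) - 1/1000) := by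
  have ha : 0 ≤ v + 2.22478 := by linarith
  have hb : 0 ≤ -v := by linarith
  have key (i j : ℕ) : 0 ≤ (v + 2.22478) ^ i * (-v) ^ j :=
    mul_nonneg (pow_nonneg ha i) (pow_nonneg hb j)
  linarith [key 0 7, key 1 6, key 2 5, key 3 4, key 4 3, key 5 2, key 6 1, key 7 0]

/-- Positivity is read off from the Bernstein coefficients on the interval. -/
lemma barrier_poly_pos_of_nonneg {v : ℝ} (hv1 : 0 ≤ v) (hv2 : v ≤ 1.57522) :
    0 < (3/100 + (15/4) * (v / 2 - 0.78761) + (18/89) * (v / 2 - 0.78761) ^ 2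
          - (136/181) * (v / 2 - 0.78761) ^ 3)
        * (1 + (15/4 + (36/89) * (v / 2 - 0.78761) - (408/181) * (v / 2 - 0.78761) ^ 2))
      + ((1/4) * (v - v ^ 3 / 6)
        + (29/18) * (v / 2 + 4.71239) * (1 - v ^ 2 / 2 + v ^ 4 / 24 - v ^ 6 / 720) - 1/1000) := by
  have hb : 0 ≤ 1.57522 - v := by linarith
  have key (i j : ℕ) : 0 ≤ v ^ i * (1.57522 - v) ^ j :=
    mul_nonneg (pow_nonneg hv1 i) (pow_nonneg hb j)
  linarith [key 0 7, key 1 6, key 2 5, key 3 4, key 4 3, key 5 2, key 6 1, key 7 0]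

/-- Lyapunov property of the cubic barrier in the second strip:
`p(x)(1 + p'(x)) − f(x) > 0` on `(18/5, 11/2)`, where
`f(x) = (1/4) sin 2x + (29/18) x cos 2x`. -/
theorem cubic_barrier_lyapunov :
    ∀ x ∈ Ioo (18/5 : ℝ) (11/2),
      barrierP x * (1 + deriv barrierP x)
        - ((1/4) * Real.sin (2 * x) + (29/18) * x * Real.cos (2 * x)) > 0 := by
  intro x hx
  have ht := trig_lower_bound hx
  obtain ⟨hx1, hx2⟩ := hx
  rw [deriv_barrierP, barrierP]
  obtain ⟨v, hv⟩ : ∃ v, v = 2 * x - 9.42478 := ⟨_, rfl⟩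
  have hy : x - 11/2 = v / 2 - 0.78761 := by linarith
  have hxv : x = v / 2 + 4.71239 := by linarith
  rw [hy]
  rw [← hv] at ht
  have hcos := mul_le_mul_of_nonneg_left (taylor_six_le_cos v)
    (by linarith : 0 ≤ (29/18) * x)
  nth_rewrite 1 [hxv] at hcos
  rcases le_total v 0 with h | h
  · linarith [barrier_poly_pos_of_nonpos (by linarith) h, taylor_five_le_sin h]
  · linarith [barrier_poly_pos_of_nonneg h (by linarith), sub_cube_le_sin h]
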